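/- arXiv:2205.08705 — 10 statements merged into one kernel-verified Lean document; each statement's English description precedes it below -/
import Mathlib

section
/- Let n ≥ 3. Let Γ₁ be the signed graph on V = Fin n ⊕ Fin n whose edges are: positive path edges (u_i, u_{i+1}) and (v_i, v_{i+1}) for 0 ≤ i ≤ n-2, a positive edge (u_0, u_{n-1}), a negative edge (u_0, v_0), and a positive edge (u_0, v_{n-1}). Let Γ₁^τ (the partial transpose of Γ₁) be obtained from Γ₁ by deleting the positive edge (u_0, v_{n-1}) and adding the positive edge (u_{n-1}, v_0). Then Γ₁ and Γ₁^τ are Laplacian cospectral and non-isomorphic. -/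
open Matrix

/-- Vertex set: `Sum.inl i` is `uᵢ`, `Sum.inr i` is `vᵢ` (0-based). -/
abbrev SV (n : ℕ) := Fin n ⊕ Fin n

/-- Signed Laplacian `L = D - A`, where `D` is the diagonal matrix of degrees
`∑ y, |A x y|`. -/
noncomputable def sLap {n : ℕ} (A : Matrix (SV n) (SV n) ℝ) : Matrix (SV n) (SV n) ℝ :=
  Matrix.diagonal (fun x => ∑ y, |A x y|) - A

/-- Symmetrize a one-sided edge-weight function into an adjacency matrix. -/
def sAdj {n : ℕ} (w : SV n → SV n → ℝ) : Matrix (SV n) (SV n) ℝ :=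
  Matrix.of fun x y => w x y + w y x

/-- Edge weights of `Γ₁`: positive paths `u₀u₁⋯u_{n-1}` and `v₀v₁⋯v_{n-1}`,
a positive edge `(u₀, u_{n-1})`, a negative edge `(u₀, v₀)` and a positive edge
`(u₀, v_{n-1})`. -/
def wG1 (n : ℕ) : SV n → SV n → ℝ
  | Sum.inl a, Sum.inl b =>
      if (b : ℕ) = (a : ℕ) + 1 then 1
      else if (a : ℕ) = 0 ∧ (b : ℕ) = n - 1 then 1 else 0
  | Sum.inl a, Sum.inr b =>
      if (a : ℕ) = 0 ∧ (b : ℕ) = 0 then -1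
      else if (a : ℕ) = 0 ∧ (b : ℕ) = n - 1 then 1 else 0
  | Sum.inr a, Sum.inr b => if (b : ℕ) = (a : ℕ) + 1 then 1 else 0
  | Sum.inr _, Sum.inl _ => 0

/-- Edge weights of the partial transpose `Γ₁^τ`: the edge `(u₀, v_{n-1})` of `Γ₁`
is replaced by the positive edge `(u_{n-1}, v₀)`. -/
def wG1t (n : ℕ) : SV n → SV n → ℝ
  | Sum.inl a, Sum.inl b =>
      if (b : ℕ) = (a : ℕ) + 1 then 1
      else if (a : ℕ) = 0 ∧ (b : ℕ) = n - 1 then 1 else 0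
  | Sum.inl a, Sum.inr b =>
      if (a : ℕ) = 0 ∧ (b : ℕ) = 0 then -1
      else if (a : ℕ) = n - 1 ∧ (b : ℕ) = 0 then 1 else 0
  | Sum.inr a, Sum.inr b => if (b : ℕ) = (a : ℕ) + 1 then 1 else 0
  | Sum.inr _, Sum.inl _ => 0

/-- Adjacency matrix of the path on `Fin n`. -/
def pathAdj (n : ℕ) : Matrix (Fin n) (Fin n) ℝ :=
  Matrix.of fun a b =>
    (if (b : ℕ) = (a : ℕ) + 1 then 1 else 0) + (if (a : ℕ) = (b : ℕ) + 1 then 1 else 0)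

/-- Laplacian of the path on `Fin n`. -/
noncomputable def pathLap (n : ℕ) : Matrix (Fin n) (Fin n) ℝ :=
  Matrix.diagonal (fun a => ∑ b, pathAdj n a b) - pathAdj n

/-- Signed incidence vectors, in terms of the coefficients `c`, `d` at the endpoints of the two
paths, of three further edges joining endpoints of two disjoint paths. -/
def endIncidence (n : ℕ) (c d : Matrix (Fin 2) (Fin 3) ℝ) : Matrix (SV n) (Fin 3) ℝ :=
  Matrix.of fun x k => match x with
    | Sum.inl a => (if (a : ℕ) = 0 then c 0 k else 0) + (if (a : ℕ) = n - 1 then c 1 k else 0)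
    | Sum.inr a => (if (a : ℕ) = 0 then d 0 k else 0) + (if (a : ℕ) = n - 1 then d 1 k else 0)

lemma pathAdj_symm (n : ℕ) (a b : Fin n) : pathAdj n a b = pathAdj n b a := by
  simp only [pathAdj, Matrix.of_apply]
  ring

lemma pathAdj_rev (n : ℕ) (a b : Fin n) : pathAdj n a.rev b.rev = pathAdj n a b := by
  simp only [pathAdj, Matrix.of_apply, Fin.val_rev]
  rw [add_comm]
  congr 1 <;> exact if_congr (by omega) rfl rfl

lemma pathLap_transpose (n : ℕ) : (pathLap n)ᵀ = pathLap n := by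
  rw [pathLap, Matrix.transpose_sub, Matrix.diagonal_transpose]
  congr 1
  ext a b
  exact pathAdj_symm n b a

lemma pathLap_submatrix_rev (n : ℕ) :
    (pathLap n).submatrix Fin.revPerm Fin.revPerm = pathLap n := by
  have h (a : Fin n) : ∑ b, pathAdj n a.rev b = ∑ b, pathAdj n a b := by
    rw [← Equiv.sum_comp Fin.revPerm]
    exact Finset.sum_congr rfl fun b _ => pathAdj_rev n a b
  ext a b
  simp only [pathLap, Matrix.submatrix_apply, Matrix.sub_apply, Fin.revPerm_apply, pathAdj_rev,
    Matrix.diagonal_apply, Fin.rev_inj, h]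

lemma pathResolvent_transpose (n : ℕ) (t : ℝ) :
    ((Matrix.scalar (Fin n) t - pathLap n)⁻¹)ᵀ = (Matrix.scalar (Fin n) t - pathLap n)⁻¹ := by
  rw [Matrix.transpose_nonsing_inv, Matrix.transpose_sub, pathLap_transpose,
    Matrix.scalar_apply, Matrix.diagonal_transpose]

lemma pathResolvent_rev (n : ℕ) (t : ℝ) (a b : Fin n) :
    (Matrix.scalar (Fin n) t - pathLap n)⁻¹ a.rev b.rev =
      (Matrix.scalar (Fin n) t - pathLap n)⁻¹ a b := by
  have h : (Matrix.scalar (Fin n) t - pathLap n).submatrix Fin.revPerm Fin.revPerm =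
      Matrix.scalar (Fin n) t - pathLap n := by
    rw [Matrix.submatrix_sub, Pi.sub_apply, Pi.sub_apply, pathLap_submatrix_rev,
      Matrix.scalar_apply, Matrix.submatrix_diagonal_equiv]
    rfl
  conv_rhs => rw [← h, Matrix.inv_submatrix_equiv]
  rfl

/-- The Gram matrix of the vectors `endIncidence n c d` depends on `R` only through its corner
entries. -/
lemma endIncidence_gram {n : ℕ} (hn : 0 < n) (c d : Matrix (Fin 2) (Fin 3) ℝ)
    (R : Matrix (Fin n) (Fin n) ℝ) :
    (endIncidence n c d)ᵀ * Matrix.fromBlocks R 0 0 R * endIncidence n c d =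
      cᵀ * !![R ⟨0, hn⟩ ⟨0, hn⟩, R ⟨0, hn⟩ ⟨n - 1, by omega⟩;
        R ⟨n - 1, by omega⟩ ⟨0, hn⟩, R ⟨n - 1, by omega⟩ ⟨n - 1, by omega⟩] * c +
      dᵀ * !![R ⟨0, hn⟩ ⟨0, hn⟩, R ⟨0, hn⟩ ⟨n - 1, by omega⟩;
        R ⟨n - 1, by omega⟩ ⟨0, hn⟩, R ⟨n - 1, by omega⟩ ⟨n - 1, by omega⟩] * d := by
  have h0 (a : Fin n) : (a : ℕ) = 0 ↔ a = ⟨0, hn⟩ := by simp [Fin.ext_iff]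
  have h1 (a : Fin n) : (a : ℕ) = n - 1 ↔ a = ⟨n - 1, by omega⟩ := by simp [Fin.ext_iff]
  ext i j
  simp [Matrix.mul_apply, endIncidence, h0, h1, Fin.sum_univ_two, add_mul, mul_add,
    Finset.sum_add_distrib]

lemma endIncidence_gram_eq {n : ℕ} (hn : 0 < n) (R : Matrix (Fin n) (Fin n) ℝ)
    (hT : Rᵀ = R) (hrev : ∀ a b : Fin n, R a.rev b.rev = R a b) :
    (endIncidence n !![1, 1, 1; -1, 0, 0] !![0, 1, 0; 0, 0, -1])ᵀ * Matrix.fromBlocks R 0 0 R *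
        endIncidence n !![1, 1, 1; -1, 0, 0] !![0, 1, 0; 0, 0, -1] =
      (endIncidence n !![1, 1, 0; -1, 0, -1] !![0, 1, 1; 0, 0, 0])ᵀ * Matrix.fromBlocks R 0 0 R *
        endIncidence n !![1, 1, 0; -1, 0, -1] !![0, 1, 1; 0, 0, 0] := by
  rw [endIncidence_gram hn, endIncidence_gram hn]
  have ha : R ⟨n - 1, by omega⟩ ⟨n - 1, by omega⟩ = R ⟨0, hn⟩ ⟨0, hn⟩ := by
    rw [← hrev ⟨0, hn⟩]
    congr 1
  have hb : R ⟨n - 1, by omega⟩ ⟨0, hn⟩ = R ⟨0, hn⟩ ⟨n - 1, by omega⟩ := by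
    conv_lhs => rw [← hT]
    rfl
  ext i j
  fin_cases i <;> fin_cases j <;>
    simp [Matrix.mul_apply, Fin.sum_univ_two, ha, hb] <;> ring

lemma charpoly_add_endIncidence {n : ℕ} (hn : 0 < n) :
    (Matrix.fromBlocks (pathLap n) 0 0 (pathLap n) +
      endIncidence n !![1, 1, 1; -1, 0, 0] !![0, 1, 0; 0, 0, -1] *
        (endIncidence n !![1, 1, 1; -1, 0, 0] !![0, 1, 0; 0, 0, -1])ᵀ).charpoly =
    (Matrix.fromBlocks (pathLap n) 0 0 (pathLap n) +
      endIncidence n !![1, 1, 0; -1, 0, -1] !![0, 1, 1; 0, 0, 0] *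
        (endIncidence n !![1, 1, 0; -1, 0, -1] !![0, 1, 1; 0, 0, 0])ᵀ).charpoly := by
  have hfin : {t : ℝ | (pathLap n).charpoly.IsRoot t}.Finite :=
    Polynomial.finite_setOfPred_isRoot (pathLap n).charpoly_monic.ne_zero
  refine Polynomial.eq_of_infinite_eval_eq _ _ (hfin.infinite_compl.mono fun t ht => ?_)
  have hdet : IsUnit (Matrix.scalar (Fin n) t - pathLap n).det := by
    rw [← Matrix.eval_charpoly]
    exact isUnit_iff_ne_zero.mpr ht
  set R := (Matrix.scalar (Fin n) t - pathLap n)⁻¹ with hR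
  have hinv : (Matrix.scalar (SV n) t - Matrix.fromBlocks (pathLap n) 0 0 (pathLap n)) *
      Matrix.fromBlocks R 0 0 R = 1 := by
    have h : Matrix.scalar (SV n) t - Matrix.fromBlocks (pathLap n) 0 0 (pathLap n) =
        Matrix.fromBlocks (Matrix.scalar (Fin n) t - pathLap n) 0 0
          (Matrix.scalar (Fin n) t - pathLap n) := by
      ext (a | a) (b | b) <;> simp [Matrix.diagonal_apply]
    rw [h, Matrix.fromBlocks_multiply, hR, Matrix.mul_nonsing_inv _ hdet]
    simp [Matrix.fromBlocks_one]
  have hunit := Matrix.isUnit_det_of_right_inverse hinv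
  have key (W : Matrix (SV n) (Fin 3) ℝ) :
      (Matrix.scalar (SV n) t - (Matrix.fromBlocks (pathLap n) 0 0 (pathLap n) + W * Wᵀ)).det =
      (Matrix.scalar (SV n) t - Matrix.fromBlocks (pathLap n) 0 0 (pathLap n)).det *
        (1 - Wᵀ * Matrix.fromBlocks R 0 0 R * W).det := by
    rw [← sub_sub, sub_eq_add_neg _ (W * Wᵀ), ← Matrix.neg_mul, Matrix.det_add_mul _ _ hunit,
      Matrix.inv_eq_right_inv hinv, Matrix.mul_neg, ← sub_eq_add_neg]
  simp only [Set.mem_ofPred_eq, Matrix.eval_charpoly, key]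
  rw [endIncidence_gram_eq hn R (pathResolvent_transpose n t) (pathResolvent_rev n t)]

lemma sum_ite_val_eq_zero {n : ℕ} (hn : 0 < n) (c : ℝ) :
    ∑ a : Fin n, (if (a : ℕ) = 0 then c else 0) = c := by
  have h0 (a : Fin n) : (a : ℕ) = 0 ↔ a = ⟨0, hn⟩ := by simp [Fin.ext_iff]
  simp [h0]

lemma sum_ite_val_eq_pred {n : ℕ} (hn : 0 < n) (c : ℝ) :
    ∑ a : Fin n, (if (a : ℕ) = n - 1 then c else 0) = c := by
  have h1 (a : Fin n) : (a : ℕ) = n - 1 ↔ a = ⟨n - 1, by omega⟩ := by simp [Fin.ext_iff]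
  simp [h1]

lemma sAdj_inl_inl {n : ℕ} (hn : 3 ≤ n) {w : SV n → SV n → ℝ}
    (hw : ∀ a b : Fin n, w (Sum.inl a) (Sum.inl b) = wG1 n (Sum.inl a) (Sum.inl b))
    (a b : Fin n) :
    sAdj w (Sum.inl a) (Sum.inl b) = pathAdj n a b +
      ((if (b : ℕ) = n - 1 then (if (a : ℕ) = 0 then 1 else 0) else 0) +
        (if (b : ℕ) = 0 then (if (a : ℕ) = n - 1 then 1 else 0) else 0)) := by
  simp only [sAdj, hw, wG1, pathAdj, Matrix.of_apply]
  split_ifs <;> first | omega | norm_num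

lemma abs_sAdj_inl_inl {n : ℕ} (hn : 3 ≤ n) {w : SV n → SV n → ℝ}
    (hw : ∀ a b : Fin n, w (Sum.inl a) (Sum.inl b) = wG1 n (Sum.inl a) (Sum.inl b))
    (a b : Fin n) :
    |sAdj w (Sum.inl a) (Sum.inl b)| = sAdj w (Sum.inl a) (Sum.inl b) := by
  rw [abs_eq_self, sAdj_inl_inl hn hw, pathAdj, Matrix.of_apply]
  positivity

lemma sAdj_inr_inr {n : ℕ} {w : SV n → SV n → ℝ}
    (hw : ∀ a b : Fin n, w (Sum.inr a) (Sum.inr b) = wG1 n (Sum.inr a) (Sum.inr b))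
    (a b : Fin n) :
    sAdj w (Sum.inr a) (Sum.inr b) = pathAdj n a b := by
  simp only [sAdj, hw, wG1, pathAdj, Matrix.of_apply]

lemma abs_pathAdj (n : ℕ) (a b : Fin n) : |pathAdj n a b| = pathAdj n a b := by
  rw [abs_eq_self, pathAdj, Matrix.of_apply]
  positivity

set_option maxHeartbeats 1000000 in
/-- Criterion for a signed Laplacian to be the Laplacian of two disjoint paths plus the Gram
matrix of the incidence vectors of three further edges. -/
lemma sLap_eq_of_cross {n : ℕ} (hn : 3 ≤ n) {w : SV n → SV n → ℝ}
    (hl : ∀ a b : Fin n, w (Sum.inl a) (Sum.inl b) = wG1 n (Sum.inl a) (Sum.inl b))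
    (hr : ∀ a b : Fin n, w (Sum.inr a) (Sum.inr b) = wG1 n (Sum.inr a) (Sum.inr b))
    (ε δ : ℝ) (hε : ε = 0 ∨ ε = 1) (hδ : δ = 1 - ε)
    (hc : ∀ a b : Fin n, sAdj w (Sum.inl a) (Sum.inr b) =
      (if (a : ℕ) = 0 ∧ (b : ℕ) = 0 then -1 else 0) +
      (if (a : ℕ) = 0 ∧ (b : ℕ) = n - 1 then ε else 0) +
      (if (a : ℕ) = n - 1 ∧ (b : ℕ) = 0 then δ else 0)) :
    sLap (sAdj w) = Matrix.fromBlocks (pathLap n) 0 0 (pathLap n) +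
      endIncidence n !![1, 1, ε; -1, 0, -δ] !![0, 1, δ; 0, 0, -ε] *
        (endIncidence n !![1, 1, ε; -1, 0, -δ] !![0, 1, δ; 0, 0, -ε])ᵀ := by
  have hs (x y : SV n) : sAdj w x y = sAdj w y x := by
    simp only [sAdj, Matrix.of_apply, add_comm]
  have habs (a b : Fin n) : |sAdj w (Sum.inl a) (Sum.inr b)| =
      (if (b : ℕ) = 0 then (if (a : ℕ) = 0 then 1 else 0) else 0) +
      (if (b : ℕ) = n - 1 then (if (a : ℕ) = 0 then ε else 0) else 0) +
      (if (b : ℕ) = 0 then (if (a : ℕ) = n - 1 then δ else 0) else 0) := by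
    rw [hc]
    rcases hε with rfl | rfl <;> subst hδ <;> split_ifs <;> first | omega | norm_num
  have habs' (a b : Fin n) : |sAdj w (Sum.inl b) (Sum.inr a)| =
      (if (b : ℕ) = 0 then (if (a : ℕ) = 0 then 1 else 0) else 0) +
      (if (b : ℕ) = 0 then (if (a : ℕ) = n - 1 then ε else 0) else 0) +
      (if (b : ℕ) = n - 1 then (if (a : ℕ) = 0 then δ else 0) else 0) := by
    rw [habs]
    split_ifs <;> first | omega | simp
  have hn0 : 0 < n := by omega
  have hdl (a : Fin n) : ∑ y, |sAdj w (Sum.inl a) y| = ∑ b, pathAdj n a b +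
      ((if (a : ℕ) = 0 then 1 else 0) + (if (a : ℕ) = n - 1 then 1 else 0)) +
      ((if (a : ℕ) = 0 then 1 else 0) + (if (a : ℕ) = 0 then ε else 0) +
        (if (a : ℕ) = n - 1 then δ else 0)) := by
    simp only [Fintype.sum_sum_type, abs_sAdj_inl_inl hn hl, habs]
    simp only [sAdj_inl_inl hn hl, Finset.sum_add_distrib, sum_ite_val_eq_zero hn0,
      sum_ite_val_eq_pred hn0]
  have hdr (a : Fin n) : ∑ y, |sAdj w (Sum.inr a) y| = ∑ b, pathAdj n a b +
      ((if (a : ℕ) = 0 then 1 else 0) + (if (a : ℕ) = n - 1 then ε else 0) +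
        (if (a : ℕ) = 0 then δ else 0)) := by
    simp only [Fintype.sum_sum_type, sAdj_inr_inr hr, abs_pathAdj, hs (Sum.inr a) (Sum.inl _),
      habs', Finset.sum_add_distrib, sum_ite_val_eq_zero hn0, sum_ite_val_eq_pred hn0]
    ring
  ext (a | a) (b | b)
  · simp only [sLap, pathLap, endIncidence, Matrix.sub_apply, Matrix.add_apply,
      Matrix.fromBlocks_apply₁₁, Matrix.mul_apply, Matrix.transpose_apply, Matrix.of_apply,
      Fin.sum_univ_three, Matrix.diagonal_apply, Sum.inl.injEq, Fin.ext_iff, hdl,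
      sAdj_inl_inl hn hl]
    generalize ∑ b, pathAdj n a b = s
    generalize pathAdj n a b = p
    simp only [Matrix.cons_val]
    rcases hε with rfl | rfl <;> subst hδ <;> split_ifs <;> first | omega | ring_nf
  · simp only [sLap, endIncidence, Matrix.sub_apply, Matrix.add_apply,
      Matrix.fromBlocks_apply₁₂, Matrix.mul_apply, Matrix.transpose_apply, Matrix.of_apply,
      Fin.sum_univ_three, Matrix.diagonal_apply, reduceCtorEq, if_false, hc, Matrix.zero_apply]
    simp only [Matrix.cons_val]
    rcases hε with rfl | rfl <;> subst hδ <;> split_ifs <;> first | omega | norm_num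
  · simp only [sLap, endIncidence, Matrix.sub_apply, Matrix.add_apply,
      Matrix.fromBlocks_apply₂₁, Matrix.mul_apply, Matrix.transpose_apply, Matrix.of_apply,
      Fin.sum_univ_three, Matrix.diagonal_apply, reduceCtorEq, if_false,
      hs (Sum.inr a) (Sum.inl b), hc, Matrix.zero_apply]
    simp only [Matrix.cons_val]
    rcases hε with rfl | rfl <;> subst hδ <;> split_ifs <;> first | omega | norm_num
  · simp only [sLap, pathLap, endIncidence, Matrix.sub_apply, Matrix.add_apply,
      Matrix.fromBlocks_apply₂₂, Matrix.mul_apply, Matrix.transpose_apply, Matrix.of_apply,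
      Fin.sum_univ_three, Matrix.diagonal_apply, Sum.inr.injEq, Fin.ext_iff, hdr,
      sAdj_inr_inr hr]
    generalize ∑ b, pathAdj n a b = s
    generalize pathAdj n a b = p
    simp only [Matrix.cons_val]
    rcases hε with rfl | rfl <;> subst hδ <;> split_ifs <;> first | omega | ring_nf

lemma sLap_wG1 {n : ℕ} (hn : 3 ≤ n) :
    sLap (sAdj (wG1 n)) = Matrix.fromBlocks (pathLap n) 0 0 (pathLap n) +
      endIncidence n !![1, 1, 1; -1, 0, 0] !![0, 1, 0; 0, 0, -1] *
        (endIncidence n !![1, 1, 1; -1, 0, 0] !![0, 1, 0; 0, 0, -1])ᵀ := by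
  have h := sLap_eq_of_cross hn (w := wG1 n) (fun _ _ => rfl) (fun _ _ => rfl) 1 0
    (Or.inr rfl) (by norm_num) fun a b => by
      simp only [sAdj, wG1, Matrix.of_apply]
      split_ifs <;> first | omega | norm_num
  rwa [neg_zero] at h

lemma sLap_wG1t {n : ℕ} (hn : 3 ≤ n) :
    sLap (sAdj (wG1t n)) = Matrix.fromBlocks (pathLap n) 0 0 (pathLap n) +
      endIncidence n !![1, 1, 0; -1, 0, -1] !![0, 1, 1; 0, 0, 0] *
        (endIncidence n !![1, 1, 0; -1, 0, -1] !![0, 1, 1; 0, 0, 0])ᵀ := by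
  have h := sLap_eq_of_cross hn (w := wG1t n) (fun _ _ => rfl) (fun _ _ => rfl) 0 1
    (Or.inl rfl) (by norm_num) fun a b => by
      simp only [sAdj, wG1t, Matrix.of_apply]
      split_ifs <;> first | omega | norm_num
  rwa [neg_zero] at h

/-- Every vertex of `Γ₁` has two distinct neighbours. -/
lemma exists_two_neighbors_wG1 {n : ℕ} (hn : 3 ≤ n) (x : SV n) :
    ∃ y z, y ≠ z ∧ sAdj (wG1 n) x y ≠ 0 ∧ sAdj (wG1 n) x z ≠ 0 := by
  rcases x with a | a
  · rcases Nat.eq_zero_or_pos a with h0 | h0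
    · refine ⟨Sum.inl ⟨1, by omega⟩, Sum.inl ⟨n - 1, by omega⟩, ?_, ?_, ?_⟩
      · simp only [ne_eq, Sum.inl.injEq, Fin.mk.injEq]
        omega
      all_goals
        simp only [sAdj, wG1, Matrix.of_apply]
        split_ifs <;> first | omega | (norm_num; done) | simp_all
    · refine ⟨Sum.inl ⟨a - 1, by omega⟩,
        Sum.inl (if h : (a : ℕ) = n - 1 then ⟨0, by omega⟩ else ⟨a + 1, by omega⟩), ?_, ?_, ?_⟩
      · split_ifs <;> simp only [ne_eq, Sum.inl.injEq, Fin.mk.injEq] <;> omega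
      all_goals
        simp only [sAdj, wG1, Matrix.of_apply]
        split_ifs <;> first | omega | (norm_num; done) | simp_all
  · refine ⟨if h : (a : ℕ) = 0 then Sum.inl ⟨0, by omega⟩ else Sum.inr ⟨a - 1, by omega⟩,
      if h : (a : ℕ) = n - 1 then Sum.inl ⟨0, by omega⟩ else Sum.inr ⟨a + 1, by omega⟩, ?_, ?_, ?_⟩
    · split_ifs <;> first | omega | simp
    all_goals
      split_ifs <;> simp only [sAdj, wG1, Matrix.of_apply] <;> split_ifs <;>
        first | omega | (norm_num; done) | simp_all

/-- The only neighbour of `v_{n-1}` in `Γ₁^τ` is `v_{n-2}`. -/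
lemma eq_of_sAdj_wG1t_ne_zero {n : ℕ} (hn : 3 ≤ n) {y : SV n}
    (hy : sAdj (wG1t n) (Sum.inr ⟨n - 1, by omega⟩) y ≠ 0) :
    y = Sum.inr ⟨n - 2, by omega⟩ := by
  contrapose! hy
  rcases y with b | b
  · simp only [sAdj, wG1t, Matrix.of_apply]
    split_ifs <;> first | omega | norm_num
  · simp only [ne_eq, Sum.inr.injEq, Fin.ext_iff] at hy
    simp only [sAdj, wG1t, Matrix.of_apply]
    split_ifs <;> first | omega | norm_num

/-- Theorem 3.1(i): `Γ₁` and its partial transpose `Γ₁^τ` are Laplacian cospectral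
and non-isomorphic. -/
theorem gamma1_partialTranspose_laplacianCospectral_nonIsomorphic
    (n : ℕ) (hn : 3 ≤ n) :
    (sLap (sAdj (wG1 n))).charpoly = (sLap (sAdj (wG1t n))).charpoly ∧
      ¬ ∃ σ : Equiv.Perm (SV n), ∀ x y, sAdj (wG1t n) (σ x) (σ y) = sAdj (wG1 n) x y := by
  constructor
  · rw [sLap_wG1 hn, sLap_wG1t hn]
    exact charpoly_add_endIncidence (by omega)
  · rintro ⟨σ, hσ⟩
    obtain ⟨y, z, hyz, hy, hz⟩ :=
      exists_two_neighbors_wG1 hn (σ.symm (Sum.inr ⟨n - 1, by omega⟩))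
    rw [← hσ, Equiv.apply_symm_apply] at hy hz
    exact hyz (σ.injective
      ((eq_of_sAdj_wG1t_ne_zero hn hy).trans (eq_of_sAdj_wG1t_ne_zero hn hz).symm))
end

section
/- Let n ≥ 4 and let 0 ≤ i < j ≤ n-1 with j - i ≥ 2 and (i, j) ≠ (0, n-1), so that u_i and u_j are nonadjacent vertices of the cycle. Let Γ₁ be the signed graph on V = Fin n ⊕ Fin n whose edges are: the all-positive cycles u_0 u_1 ⋯ u_{n-1} u_0 and v_0 v_1 ⋯ v_{n-1} v_0, a positive edge (u_i, u_j), a negative edge (u_i, v_i), and a positive edge (u_i, v_j). Let Γ₁^τ (the partial transpose) be obtained from Γ₁ by deleting the positive edge (u_i, v_j) and adding the positive edge (u_j, v_i). Then Γ₁ and Γ₁^τ are Laplacian cospectral and non-isomorphic. -/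
open Matrix

/-- Edge weights of `Γ₁`: two all-positive cycles `u₀u₁⋯u_{n-1}u₀` and
`v₀v₁⋯v_{n-1}v₀`, a positive chord `(u_i,u_j)`, a negative edge `(u_i,v_i)` and a
positive edge `(u_i,v_j)`. -/
def wC1 (n i j : ℕ) : SV n → SV n → ℝ
  | Sum.inl a, Sum.inl b =>
      if (b : ℕ) = (a : ℕ) + 1 then 1
      else if (a : ℕ) = 0 ∧ (b : ℕ) = n - 1 then 1
      else if (a : ℕ) = i ∧ (b : ℕ) = j then 1 else 0
  | Sum.inl a, Sum.inr b =>
      if (a : ℕ) = i ∧ (b : ℕ) = i then -1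
      else if (a : ℕ) = i ∧ (b : ℕ) = j then 1 else 0
  | Sum.inr a, Sum.inr b =>
      if (b : ℕ) = (a : ℕ) + 1 then 1
      else if (a : ℕ) = 0 ∧ (b : ℕ) = n - 1 then 1 else 0
  | Sum.inr _, Sum.inl _ => 0

/-- Edge weights of the partial transpose `Γ₁^τ`: the positive edge `(u_i,v_j)` of
`Γ₁` is replaced by the positive edge `(u_j,v_i)`. -/
def wC1t (n i j : ℕ) : SV n → SV n → ℝ
  | Sum.inl a, Sum.inl b =>
      if (b : ℕ) = (a : ℕ) + 1 then 1
      else if (a : ℕ) = 0 ∧ (b : ℕ) = n - 1 then 1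
      else if (a : ℕ) = i ∧ (b : ℕ) = j then 1 else 0
  | Sum.inl a, Sum.inr b =>
      if (a : ℕ) = i ∧ (b : ℕ) = i then -1
      else if (a : ℕ) = j ∧ (b : ℕ) = i then 1 else 0
  | Sum.inr a, Sum.inr b =>
      if (b : ℕ) = (a : ℕ) + 1 then 1
      else if (a : ℕ) = 0 ∧ (b : ℕ) = n - 1 then 1 else 0
  | Sum.inr _, Sum.inl _ => 0

section PartialTranspose

variable {n : ℕ}

/-- The matrix which exchanges the two copies of `Fin n` on vectors invariant under `R` and
fixes the vectors on which `R` acts as `-1`. -/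
noncomputable def symmetricSwap (R : Matrix (Fin n) (Fin n) ℝ) : Matrix (SV n) (SV n) ℝ :=
  (1 / 2 : ℝ) • Matrix.fromBlocks (1 - R) (1 + R) (1 + R) (1 - R)

lemma symmetricSwap_mul_self {R : Matrix (Fin n) (Fin n) ℝ} (hR : R * R = 1) :
    symmetricSwap R * symmetricSwap R = 1 := by
  have h₁ : (1 - R) * (1 - R) + (1 + R) * (1 + R) = (4 : ℝ) • 1 := by
    simp only [add_mul, mul_add, sub_mul, mul_sub, mul_one, one_mul, hR]
    module
  have h₂ : (1 - R) * (1 + R) + (1 + R) * (1 - R) = 0 := by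
    simp only [add_mul, mul_add, sub_mul, mul_sub, mul_one, one_mul, hR]
    abel
  have h₃ : (1 + R) * (1 - R) + (1 - R) * (1 + R) = 0 := by rw [add_comm, h₂]
  have h₄ : (1 + R) * (1 + R) + (1 - R) * (1 - R) = (4 : ℝ) • 1 := by rw [add_comm, h₁]
  rw [symmetricSwap, smul_mul_smul_comm, Matrix.fromBlocks_multiply, h₁, h₂, h₃, h₄,
    Matrix.fromBlocks_smul, smul_smul, smul_zero, ← Matrix.fromBlocks_one]
  norm_num

/-- Adding the edge set `u_I u_J`, `-u_I v_I`, `u_I v_J` to two copies of a graph with Laplacian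
`C`, or its partial transpose, gives cospectral matrices whenever an involution `R` commuting
with `C` exchanges `I` and `J`. -/
lemma charpoly_fromBlocks_eq_partialTranspose {C R : Matrix (Fin n) (Fin n) ℝ} {I J : Fin n}
    (hR : R * R = 1) (hC : R * C = C * R)
    (hIl : ∀ k, R * Matrix.single I k 1 = Matrix.single J k 1)
    (hJl : ∀ k, R * Matrix.single J k 1 = Matrix.single I k 1)
    (hIr : ∀ k, Matrix.single k I 1 * R = Matrix.single k J 1)
    (hJr : ∀ k, Matrix.single k J 1 * R = Matrix.single k I 1) :
    (Matrix.fromBlocks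
      (C + 3 • single I I 1 + single J J 1 - single I J 1 - single J I 1)
      (single I I 1 - single I J 1) (single I I 1 - single J I 1)
      (C + single I I 1 + single J J 1)).charpoly =
    (Matrix.fromBlocks
      (C + 2 • single I I 1 + 2 • single J J 1 - single I J 1 - single J I 1)
      (single I I 1 - single J I 1) (single I I 1 - single I J 1)
      (C + 2 • single I I 1)).charpoly := by
  set L := Matrix.fromBlocks
      (C + 3 • single I I 1 + single J J 1 - single I J 1 - single J I 1)
      (single I I 1 - single I J 1) (single I I 1 - single J I 1)
      (C + single I I 1 + single J J 1) with hL
  set M := Matrix.fromBlocks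
      (C + 2 • single I I 1 + 2 • single J J 1 - single I J 1 - single J I 1)
      (single I I 1 - single J I 1) (single I I 1 - single I J 1)
      (C + 2 • single I I 1) with hM
  have hLM : L * symmetricSwap R = symmetricSwap R * M := by
    rw [hL, hM, symmetricSwap, Matrix.mul_smul, Matrix.smul_mul, Matrix.fromBlocks_multiply,
      Matrix.fromBlocks_multiply]
    congr 2 <;>
    · simp only [mul_add, add_mul, mul_sub, sub_mul, mul_one, one_mul, smul_mul_assoc,
        mul_smul_comm, hC, hIl, hJl, hIr, hJr]
      abel
  have hQ := symmetricSwap_mul_self hR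
  calc L.charpoly = (symmetricSwap R * (M * symmetricSwap R)).charpoly := by
        rw [← mul_assoc, ← hLM, mul_assoc, hQ, mul_one]
    _ = M.charpoly := by rw [Matrix.charpoly_mul_comm, mul_assoc, hQ, mul_one]

/-- Adjacency of the cycle on `Fin n`. -/
def cycleAdj [NeZero n] (a b : Fin n) : ℝ :=
  (if b = a + 1 then 1 else 0) + if a = b + 1 then 1 else 0

lemma cycleAdj_nonneg [NeZero n] (a b : Fin n) : 0 ≤ cycleAdj a b := by
  unfold cycleAdj; positivity

lemma sum_cycleAdj [NeZero n] (a : Fin n) : ∑ b, cycleAdj a b = 2 := by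
  have h : ∀ b : Fin n, a = b + 1 ↔ b = a - 1 := fun b => by
    rw [eq_sub_iff_add_eq, eq_comm]
  simp only [cycleAdj, Finset.sum_add_distrib, h, Finset.sum_ite_eq', Finset.mem_univ, if_true]
  norm_num

lemma cycleAdj_sub_sub [NeZero n] (s a b : Fin n) :
    cycleAdj (s - a) (s - b) = cycleAdj a b := by
  have h : ∀ a b : Fin n, s - b = s - a + 1 ↔ a = b + 1 := fun a b => by
    rw [sub_add, sub_right_inj, eq_sub_iff_add_eq, eq_comm]
  simp only [cycleAdj, h]
  rw [add_comm]

lemma Fin.eq_add_one_iff_val [NeZero n] (hn : 2 ≤ n) (a b : Fin n) :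
    b = a + 1 ↔ (b : ℕ) = a + 1 ∨ (a : ℕ) = n - 1 ∧ (b : ℕ) = 0 := by
  have hb := b.isLt
  have ha := a.isLt
  rw [Fin.ext_iff, Fin.val_add, Fin.val_one', Nat.mod_eq_of_lt (a := 1) (by omega)]
  rcases Nat.lt_or_ge (a + 1 : ℕ) n with h | h
  · rw [Nat.mod_eq_of_lt h]; omega
  · rw [show (a + 1 : ℕ) = n by omega, Nat.mod_self]; omega

lemma cycleAdj_eq_val [NeZero n] (hn : 3 ≤ n) (a b : Fin n) :
    cycleAdj a b =
      if (b : ℕ) = a + 1 ∨ (a : ℕ) = b + 1 ∨ (a : ℕ) = 0 ∧ (b : ℕ) = n - 1 ∨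
        (b : ℕ) = 0 ∧ (a : ℕ) = n - 1 then 1 else 0 := by
  simp only [cycleAdj, Fin.eq_add_one_iff_val (by omega : 2 ≤ n)]
  split_ifs <;> first | omega | norm_num

lemma sAdj_comm (w : SV n → SV n → ℝ) (x y : SV n) : sAdj w x y = sAdj w y x := by
  simp only [sAdj, Matrix.of_apply, add_comm]

section Entries

variable {I J : Fin n}

lemma sAdj_wC1_inl_inr (hIJ : I ≠ J) (a b : Fin n) :
    sAdj (wC1 n I J) (Sum.inl a) (Sum.inr b) = single I J 1 a b - single I I 1 a b := by
  rw [ne_eq, Fin.ext_iff] at hIJ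
  simp only [sAdj, wC1, Matrix.of_apply, Matrix.single_apply, Fin.ext_iff]
  split_ifs <;> first | omega | norm_num

lemma sAdj_wC1t_inl_inr (hIJ : I ≠ J) (a b : Fin n) :
    sAdj (wC1t n I J) (Sum.inl a) (Sum.inr b) = single J I 1 a b - single I I 1 a b := by
  rw [ne_eq, Fin.ext_iff] at hIJ
  simp only [sAdj, wC1t, Matrix.of_apply, Matrix.single_apply, Fin.ext_iff]
  split_ifs <;> first | omega | norm_num

lemma sum_single_row (a : Fin n) :
    ∑ b, single I J (1 : ℝ) a b = if a = I then 1 else 0 := by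
  simp [single_apply, ite_and, eq_comm]

lemma sum_single_col (b : Fin n) :
    ∑ a, single I J (1 : ℝ) a b = if b = J then 1 else 0 := by
  simp [single_apply, ite_and, eq_comm]

lemma single_one_nonneg (a b : Fin n) : 0 ≤ single I J (1 : ℝ) a b := by
  rw [single_apply]; positivity

lemma abs_single_sub_single {K L : Fin n} (h : I ≠ K ∨ J ≠ L) (a b : Fin n) :
    |single I J (1 : ℝ) a b - single K L 1 a b| = single I J 1 a b + single K L 1 a b := by
  simp only [single_apply]
  split_ifs <;> first | (exfalso; grind) | norm_num

variable [NeZero n]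

lemma sAdj_wC1_inr_inr (hn : 3 ≤ n) (a b : Fin n) :
    sAdj (wC1 n I J) (Sum.inr a) (Sum.inr b) = cycleAdj a b := by
  simp only [sAdj, wC1, Matrix.of_apply, cycleAdj_eq_val hn]
  split_ifs <;> first | omega | norm_num

lemma sAdj_wC1t_inr_inr (hn : 3 ≤ n) (a b : Fin n) :
    sAdj (wC1t n I J) (Sum.inr a) (Sum.inr b) = cycleAdj a b :=
  sAdj_wC1_inr_inr (I := I) (J := J) hn a b

lemma sAdj_wC1_inl_inl (hn : 3 ≤ n) (hIJ : (I : ℕ) + 2 ≤ J)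
    (hne : ¬((I : ℕ) = 0 ∧ (J : ℕ) = n - 1)) (a b : Fin n) :
    sAdj (wC1 n I J) (Sum.inl a) (Sum.inl b) =
      cycleAdj a b + single I J 1 a b + single J I 1 a b := by
  simp only [sAdj, wC1, Matrix.of_apply, cycleAdj_eq_val hn, Matrix.single_apply, Fin.ext_iff]
  split_ifs <;> first | omega | norm_num

lemma sAdj_wC1t_inl_inl (hn : 3 ≤ n) (hIJ : (I : ℕ) + 2 ≤ J)
    (hne : ¬((I : ℕ) = 0 ∧ (J : ℕ) = n - 1)) (a b : Fin n) :
    sAdj (wC1t n I J) (Sum.inl a) (Sum.inl b) =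
      cycleAdj a b + single I J 1 a b + single J I 1 a b :=
  sAdj_wC1_inl_inl hn hIJ hne a b

lemma abs_cycleAdj_add_single (a b : Fin n) :
    |cycleAdj a b + single I J 1 a b + single J I 1 a b| =
      cycleAdj a b + single I J 1 a b + single J I 1 a b :=
  abs_of_nonneg <| add_nonneg (add_nonneg (cycleAdj_nonneg a b) (single_one_nonneg a b))
    (single_one_nonneg a b)

lemma degree_wC1_inl (hn : 3 ≤ n) (hIJ : (I : ℕ) + 2 ≤ J)
    (hne : ¬((I : ℕ) = 0 ∧ (J : ℕ) = n - 1)) (a : Fin n) :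
    ∑ y, |sAdj (wC1 n I J) (Sum.inl a) y| =
      2 + (if a = I then 3 else 0) + if a = J then 1 else 0 := by
  have h : I ≠ J := by rintro rfl; omega
  simp only [Fintype.sum_sum_type, sAdj_wC1_inl_inl hn hIJ hne, sAdj_wC1_inl_inr h,
    abs_cycleAdj_add_single, abs_single_sub_single (Or.inr h.symm), Finset.sum_add_distrib,
    sum_cycleAdj, sum_single_row]
  split_ifs <;> norm_num

lemma degree_wC1_inr (hn : 3 ≤ n) (h : I ≠ J) (a : Fin n) :
    ∑ y, |sAdj (wC1 n I J) (Sum.inr a) y| =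
      2 + (if a = I then 1 else 0) + if a = J then 1 else 0 := by
  simp only [Fintype.sum_sum_type, sAdj_comm _ (Sum.inr a) (Sum.inl _), sAdj_wC1_inl_inr h,
    sAdj_wC1_inr_inr hn, abs_of_nonneg (cycleAdj_nonneg _ _),
    abs_single_sub_single (Or.inr h.symm), Finset.sum_add_distrib, sum_cycleAdj, sum_single_col]
  split_ifs <;> norm_num

lemma degree_wC1t_inl (hn : 3 ≤ n) (hIJ : (I : ℕ) + 2 ≤ J)
    (hne : ¬((I : ℕ) = 0 ∧ (J : ℕ) = n - 1)) (a : Fin n) :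
    ∑ y, |sAdj (wC1t n I J) (Sum.inl a) y| =
      2 + (if a = I then 2 else 0) + if a = J then 2 else 0 := by
  have h : I ≠ J := by rintro rfl; omega
  simp only [Fintype.sum_sum_type, sAdj_wC1t_inl_inl hn hIJ hne, sAdj_wC1t_inl_inr h,
    abs_cycleAdj_add_single, abs_single_sub_single (Or.inl h.symm), Finset.sum_add_distrib,
    sum_cycleAdj, sum_single_row]
  split_ifs <;> norm_num

lemma degree_wC1t_inr (hn : 3 ≤ n) (h : I ≠ J) (a : Fin n) :
    ∑ y, |sAdj (wC1t n I J) (Sum.inr a) y| = 2 + if a = I then 2 else 0 := by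
  simp only [Fintype.sum_sum_type, sAdj_comm _ (Sum.inr a) (Sum.inl _), sAdj_wC1t_inl_inr h,
    sAdj_wC1t_inr_inr hn, abs_of_nonneg (cycleAdj_nonneg _ _),
    abs_single_sub_single (Or.inl h.symm), Finset.sum_add_distrib, sum_cycleAdj, sum_single_col]
  split_ifs <;> norm_num

lemma degree_wC1t_le (hn : 3 ≤ n) (hIJ : (I : ℕ) + 2 ≤ J)
    (hne : ¬((I : ℕ) = 0 ∧ (J : ℕ) = n - 1)) (x : SV n) :
    ∑ y, |sAdj (wC1t n I J) x y| ≤ 4 := by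
  have h : I ≠ J := by rintro rfl; omega
  rcases x with a | a
  · rw [degree_wC1t_inl hn hIJ hne]
    split_ifs with h₁ h₂
    · exact absurd (h₁.symm.trans h₂) h
    all_goals norm_num
  · rw [degree_wC1t_inr hn h]
    split_ifs <;> norm_num

/-- Laplacian of the cycle on `Fin n`. -/
noncomputable def cycleLap (n : ℕ) [NeZero n] : Matrix (Fin n) (Fin n) ℝ :=
  2 • 1 - Matrix.of cycleAdj

lemma sLap_wC1 (hn : 3 ≤ n) (hIJ : (I : ℕ) + 2 ≤ J)
    (hne : ¬((I : ℕ) = 0 ∧ (J : ℕ) = n - 1)) :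
    sLap (sAdj (wC1 n I J)) = Matrix.fromBlocks
      (cycleLap n + 3 • single I I 1 + single J J 1 - single I J 1 - single J I 1)
      (single I I 1 - single I J 1) (single I I 1 - single J I 1)
      (cycleLap n + single I I 1 + single J J 1) := by
  have h : I ≠ J := by rintro rfl; omega
  ext (a | a) (b | b)
  · simp only [sLap, Matrix.sub_apply, diagonal_apply, degree_wC1_inl hn hIJ hne,
      sAdj_wC1_inl_inl hn hIJ hne, fromBlocks_apply₁₁, cycleLap, Matrix.add_apply, Matrix.smul_apply, Matrix.one_apply,
      of_apply, Sum.inl.injEq, single_apply]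
    grind
  · simp [sLap, sAdj_wC1_inl_inr h]
  · simp [sLap, sAdj_comm _ (Sum.inr a) (Sum.inl b), sAdj_wC1_inl_inr h, single_apply, and_comm]
  · simp only [sLap, Matrix.sub_apply, diagonal_apply, degree_wC1_inr hn h,
      sAdj_wC1_inr_inr hn, fromBlocks_apply₂₂, cycleLap, Matrix.add_apply, Matrix.smul_apply, Matrix.one_apply,
      of_apply, Sum.inr.injEq, single_apply]
    grind

lemma sLap_wC1t (hn : 3 ≤ n) (hIJ : (I : ℕ) + 2 ≤ J)
    (hne : ¬((I : ℕ) = 0 ∧ (J : ℕ) = n - 1)) :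
    sLap (sAdj (wC1t n I J)) = Matrix.fromBlocks
      (cycleLap n + 2 • single I I 1 + 2 • single J J 1 - single I J 1 - single J I 1)
      (single I I 1 - single J I 1) (single I I 1 - single I J 1)
      (cycleLap n + 2 • single I I 1) := by
  have h : I ≠ J := by rintro rfl; omega
  ext (a | a) (b | b)
  · simp only [sLap, Matrix.sub_apply, diagonal_apply, degree_wC1t_inl hn hIJ hne,
      sAdj_wC1t_inl_inl hn hIJ hne, fromBlocks_apply₁₁, cycleLap, Matrix.add_apply, Matrix.smul_apply,
      Matrix.one_apply, of_apply, Sum.inl.injEq, single_apply]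
    grind
  · simp [sLap, sAdj_wC1t_inl_inr h]
  · simp [sLap, sAdj_comm _ (Sum.inr a) (Sum.inl b), sAdj_wC1t_inl_inr h, single_apply, and_comm]
  · simp only [sLap, Matrix.sub_apply, diagonal_apply, degree_wC1t_inr hn h,
      sAdj_wC1t_inr_inr hn, fromBlocks_apply₂₂, cycleLap, Matrix.add_apply, Matrix.smul_apply, Matrix.one_apply,
      of_apply, Sum.inr.injEq, single_apply]
    grind

end Entries

/-- Permutation matrix of the reflection `k ↦ s - k` of the cycle on `Fin n`. -/
def reflection [NeZero n] (s : Fin n) : Matrix (Fin n) (Fin n) ℝ :=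
  Equiv.Perm.permMatrix ℝ (Equiv.subLeft s)

lemma reflection_mul [NeZero n] (s : Fin n) (A : Matrix (Fin n) (Fin n) ℝ) :
    reflection s * A = A.submatrix (s - ·) id :=
  PEquiv.toMatrix_toPEquiv_mul _ _

lemma mul_reflection [NeZero n] (s : Fin n) (A : Matrix (Fin n) (Fin n) ℝ) :
    A * reflection s = A.submatrix id (s - ·) := by
  refine (PEquiv.mul_toMatrix_toPEquiv A (Equiv.subLeft s)).trans ?_
  ext a b
  simp [sub_eq_neg_add]

lemma reflection_mul_self [NeZero n] (s : Fin n) : reflection s * reflection s = 1 := by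
  rw [reflection, ← Matrix.permMatrix_mul, ← Matrix.permMatrix_one]
  congr 1
  ext a
  simp

lemma reflection_mul_cycleLap [NeZero n] (s : Fin n) :
    reflection s * cycleLap n = cycleLap n * reflection s := by
  have h : reflection s * Matrix.of cycleAdj = Matrix.of cycleAdj * reflection s := by
    rw [reflection_mul, mul_reflection]
    ext a b
    simpa using cycleAdj_sub_sub s a (s - b)
  rw [cycleLap, mul_sub, sub_mul, h, mul_smul_comm, smul_mul_assoc, mul_one, one_mul]

lemma reflection_mul_single [NeZero n] (s a b : Fin n) :
    reflection s * single a b 1 = single (s - a) b 1 := by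
  rw [reflection_mul]
  ext x y
  simp [single_apply, eq_sub_iff_add_eq, add_comm, eq_comm]

lemma single_mul_reflection [NeZero n] (s a b : Fin n) :
    single a b 1 * reflection s = single a (s - b) 1 := by
  rw [mul_reflection]
  ext x y
  simp [single_apply, eq_sub_iff_add_eq, add_comm, eq_comm]

end PartialTranspose


/-- Theorem 3.2(i): `Γ₁` and its partial transpose `Γ₁^τ` are Laplacian cospectral
and non-isomorphic. -/
theorem cycleGamma1_partialTranspose_laplacianCospectral_nonIsomorphic
    (n i j : ℕ) (hn : 4 ≤ n) (hij : i < j) (hj : j ≤ n - 1)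
    (hgap : 2 ≤ j - i) (hne : (i, j) ≠ (0, n - 1)) :
    (sLap (sAdj (wC1 n i j))).charpoly = (sLap (sAdj (wC1t n i j))).charpoly ∧
      ¬ ∃ σ : Equiv.Perm (SV n), ∀ x y,
          sAdj (wC1t n i j) (σ x) (σ y) = sAdj (wC1 n i j) x y := by
  have : NeZero n := ⟨by omega⟩
  obtain ⟨I, rfl⟩ : ∃ I : Fin n, (I : ℕ) = i := ⟨⟨i, by omega⟩, rfl⟩
  obtain ⟨J, rfl⟩ : ∃ J : Fin n, (J : ℕ) = j := ⟨⟨j, by omega⟩, rfl⟩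
  have hn' : 3 ≤ n := by omega
  have hIJ : (I : ℕ) + 2 ≤ J := by omega
  rw [ne_eq, Prod.mk.injEq] at hne
  constructor
  · rw [sLap_wC1 hn' hIJ hne, sLap_wC1t hn' hIJ hne]
    apply charpoly_fromBlocks_eq_partialTranspose (R := reflection (I + J))
      (reflection_mul_self _) (reflection_mul_cycleLap _) <;>
    · intro k
      simp [reflection_mul_single, single_mul_reflection]
  · rintro ⟨σ, hσ⟩
    have h := degree_wC1t_le hn' hIJ hne (σ (Sum.inl I))
    rw [← Equiv.sum_comp σ] at h
    simp only [hσ] at h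
    rw [degree_wC1_inl hn' hIJ hne, if_pos rfl] at h
    split_ifs at h <;> norm_num at h
end

section
/- Let B : Matrix (Fin n) (Fin m) ℝ be an incidence matrix of a signed graph Γ and let p be a positive integer. Then in ℝ[X], X^n * charpoly(M_p B) = X^(p*m) * (charpoly((p : ℝ) • (B * Bᵀ))).comp (X^2). In particular, the nonzero eigenvalues of M_p B are exactly ±√(p·μ) as μ ranges over the nonzero eigenvalues of the Laplacian L = B * Bᵀ (with multiplicity), and all remaining eigenvalues of M_p B are 0. -/
open Matrix Polynomial

/-- `B` is an incidence matrix of a signed graph: each column has exactly two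
nonzero entries, each equal to `1` or `-1`. -/
def IsIncidence {n m : ℕ} (B : Matrix (Fin n) (Fin m) ℝ) : Prop :=
  ∀ j : Fin m, ∃ a b : Fin n, a ≠ b ∧
    (B a j = 1 ∨ B a j = -1) ∧ (B b j = 1 ∨ B b j = -1) ∧
    ∀ c : Fin n, c ≠ a → c ≠ b → B c j = 0

/-- Adjacency matrix of the signed graph `S_p(Γ)` of Operation 4.1, built from an
incidence matrix `B` of `Γ`. -/
def Mp {n m : ℕ} (p : ℕ) (B : Matrix (Fin n) (Fin m) ℝ) :
    Matrix (Fin n ⊕ (Fin p × Fin m)) (Fin n ⊕ (Fin p × Fin m)) ℝ :=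
  Matrix.of fun x y =>
    match x, y with
    | Sum.inl i, Sum.inr aj => B i aj.2
    | Sum.inr aj, Sum.inl i => B i aj.2
    | _, _ => 0

/-- The characteristic polynomial of an off-diagonal block matrix. -/
theorem Matrix.X_pow_mul_charpoly_fromBlocks_zero {R ι κ : Type*} [CommRing R]
    [Fintype ι] [DecidableEq ι] [Fintype κ] [DecidableEq κ]
    (C : Matrix ι κ R) (D : Matrix κ ι R) :
    X ^ Fintype.card ι * (fromBlocks 0 C D 0).charpoly =
      X ^ Fintype.card κ * ((C * D).charpoly).comp (X ^ 2) := by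
  have hprod : fromBlocks (scalar ι (X : R[X])) (C.map Polynomial.C) 0 1 *
      charmatrix (fromBlocks 0 C D 0) =
      fromBlocks (scalar ι (X ^ 2 : R[X]) - (C * D).map Polynomial.C) 0
        (-D.map Polynomial.C) (scalar κ X) := by
    rw [charmatrix_fromBlocks, fromBlocks_multiply]
    congr 1 <;> ext1 i j <;>
      simp [charmatrix, pow_two, sub_eq_add_neg, X_mul_C]
  have hcomp : ((C * D).charpoly).comp (X ^ 2) =
      (scalar ι (X ^ 2 : R[X]) - (C * D).map Polynomial.C).det := by
    rw [charpoly, ← coe_compRingHom_apply, RingHom.map_det]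
    congr 1
    ext1 i j
    by_cases h : i = j <;> simp [-Matrix.map_mul, h]
  have hdet := congrArg det hprod
  rw [det_mul, det_fromBlocks_zero₂₁, det_fromBlocks_zero₁₂, ← hcomp] at hdet
  simpa [charpoly, mul_comm] using hdet

theorem Mp_eq_fromBlocks {n m : ℕ} (p : ℕ) (B : Matrix (Fin n) (Fin m) ℝ) :
    Mp p B = fromBlocks 0 (of fun i (aj : Fin p × Fin m) => B i aj.2)
      (of fun (aj : Fin p × Fin m) i => B i aj.2) 0 := by
  ext (i | i) (j | j) <;> rfl

/-- Theorem 4.2: `X^n * charpoly (S_p(Γ)) = X^(p*m) * charpoly (p • L) ∘ X²`,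
where `L = B * Bᵀ` is the signed Laplacian; i.e. the nonzero eigenvalues of
`S_p(Γ)` are exactly `±√(p μ)` over the nonzero Laplacian eigenvalues `μ`, and the
rest are `0`. -/
theorem charpoly_Mp {n m : ℕ} (B : Matrix (Fin n) (Fin m) ℝ)
    (hB : IsIncidence B) (p : ℕ) (hp : 0 < p) :
    X ^ n * (Mp p B).charpoly =
      X ^ (p * m) * (((p : ℝ) • (B * Bᵀ)).charpoly).comp (X ^ 2) := by
  have hmul : (of fun i (aj : Fin p × Fin m) => B i aj.2) *
      (of fun (aj : Fin p × Fin m) i => B i aj.2) = (p : ℝ) • (B * Bᵀ) := by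
    ext i j
    simp [mul_apply, Fintype.sum_prod_type]
  simpa [Mp_eq_fromBlocks, hmul] using X_pow_mul_charpoly_fromBlocks_zero
    (of fun i (aj : Fin p × Fin m) => B i aj.2) (of fun (aj : Fin p × Fin m) i => B i aj.2)
end

section
/- Let B : Matrix (Fin n) (Fin m) ℝ be an incidence matrix of a signed graph Γ and let M be the adjacency matrix of its subdivision signed graph S(Γ), i.e. the symmetric matrix on Fin n ⊕ Fin m whose (Sum.inl i, Sum.inr j) and (Sum.inr j, Sum.inl i) entries equal B i j and whose other entries are 0. Then in ℝ[X], X^n * charpoly(M) = X^m * (charpoly(B * Bᵀ)).comp (X^2); equivalently, the nonzero eigenvalues of S(Γ) are exactly ±√μ as μ ranges over the nonzero Laplacian eigenvalues of Γ (with multiplicity), and all remaining eigenvalues are 0. -/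
open Matrix Polynomial

/-- Adjacency matrix of the subdivision signed graph `S(Γ)`, built from an
incidence matrix `B` of `Γ`. -/
def subdivAdj {n m : ℕ} (B : Matrix (Fin n) (Fin m) ℝ) :
    Matrix (Fin n ⊕ Fin m) (Fin n ⊕ Fin m) ℝ :=
  Matrix.of fun x y =>
    match x, y with
    | Sum.inl i, Sum.inr j => B i j
    | Sum.inr j, Sum.inl i => B i j
    | _, _ => 0

theorem Matrix.charpoly_comp_X_sq {R ι : Type*} [CommRing R] [Fintype ι] [DecidableEq ι]
    (A : Matrix ι ι R) :
    A.charpoly.comp (X ^ 2) = (scalar ι (X ^ 2 : R[X]) - A.map C).det := by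
  rw [charpoly, ← coe_compRingHom_apply, RingHom.map_det]
  congr 1
  ext i j : 1
  by_cases h : i = j <;> simp [h]

theorem Matrix.X_pow_mul_charpoly_fromBlocks_zero_zero {R ι κ : Type*} [CommRing R]
    [Fintype ι] [Fintype κ] [DecidableEq ι] [DecidableEq κ]
    (B : Matrix ι κ R) (D : Matrix κ ι R) :
    X ^ Fintype.card ι * (fromBlocks 0 B D 0).charpoly =
      X ^ Fintype.card κ * (B * D).charpoly.comp (X ^ 2) := by
  have hmul : (fromBlocks 0 B D 0).charmatrix * fromBlocks (scalar ι X) 0 (D.map C) 1 =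
      fromBlocks (scalar ι (X ^ 2 : R[X]) - (B * D).map C) (-B.map C) 0 (scalar κ X) := by
    rw [charmatrix_fromBlocks, fromBlocks_multiply, Matrix.map_mul]
    congr 1 <;> ext i j : 1
    · simp [pow_two, sub_eq_add_neg, charmatrix]
    · simp
    · simp [charmatrix, mul_comm X]
    · simp [charmatrix]
  have hdet := congrArg det hmul
  rw [det_mul, det_fromBlocks_zero₁₂, det_fromBlocks_zero₂₁, ← charpoly_comp_X_sq] at hdet
  simpa [charpoly, mul_comm] using hdet

theorem subdivAdj_eq_fromBlocks {n m : ℕ} (B : Matrix (Fin n) (Fin m) ℝ) :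
    subdivAdj B = fromBlocks 0 B Bᵀ 0 := by
  ext (i | i) (j | j) <;> rfl

/-- Corollary 4.3: `X^n * charpoly (S(Γ)) = X^m * charpoly (L) ∘ X²`, where
`L = B * Bᵀ` is the signed Laplacian; i.e. the nonzero eigenvalues of `S(Γ)` are
exactly `±√μ` over the nonzero Laplacian eigenvalues `μ` of `Γ`, and all remaining
eigenvalues are `0`. -/
theorem charpoly_subdivAdj {n m : ℕ} (B : Matrix (Fin n) (Fin m) ℝ)
    (hB : IsIncidence B) :
    X ^ n * (subdivAdj B).charpoly =
      X ^ m * ((B * Bᵀ).charpoly).comp (X ^ 2) := by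
  simpa [subdivAdj_eq_fromBlocks] using X_pow_mul_charpoly_fromBlocks_zero_zero B Bᵀ
end

section
/- Let B : Matrix (Fin n) (Fin m) ℝ be an incidence matrix of a signed graph Γ, let p be a positive integer and let k = p or k = p - 1. Then in ℝ[X], X^(2*n) * charpoly(N_{p,k} B) = X^((p+1)*n + (k+1)*m) * (charpoly(((p+1)*(k+1) : ℝ) • (B * Bᵀ))).comp (X^2). In particular, the nonzero eigenvalues of N_{p,k} B are exactly ±√((p+1)(k+1)·μ) as μ ranges over the nonzero eigenvalues of the Laplacian L = B * Bᵀ (with multiplicity), and all remaining eigenvalues are 0. -/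
open Matrix Polynomial

/-- Adjacency matrix of the signed graph `S_p^k(Γ)` of Operation 4.2, built from an
incidence matrix `B` of `Γ`. -/
def Npk {n m : ℕ} (p k : ℕ) (B : Matrix (Fin n) (Fin m) ℝ) :
    Matrix ((Fin (p + 1) × Fin n) ⊕ (Fin (k + 1) × Fin m))
      ((Fin (p + 1) × Fin n) ⊕ (Fin (k + 1) × Fin m)) ℝ :=
  Matrix.of fun x y =>
    match x, y with
    | Sum.inl ai, Sum.inr bj => B ai.2 bj.2
    | Sum.inr bj, Sum.inl ai => B ai.2 bj.2
    | _, _ => 0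

namespace Matrix

variable {R ι κ : Type*} [CommRing R] [Fintype ι] [DecidableEq ι] [Fintype κ] [DecidableEq κ]

/-- Substituting `q` for the variable in the characteristic polynomial. -/
theorem charpoly_comp (M : Matrix ι ι R) (q : R[X]) :
    M.charpoly.comp q = (scalar ι q - M.map C).det := by
  rw [charpoly, ← coe_compRingHom_apply, RingHom.map_det]
  congr 1
  ext1 i j
  by_cases h : i = j
  · subst h
    simp
  · simp [h]

/-- The characteristic polynomial of a block anti-diagonal matrix. -/
theorem X_pow_mul_charpoly_fromBlocks_zero_zero_s7 (M : Matrix ι κ R) (N : Matrix κ ι R) :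
    X ^ Fintype.card ι * (fromBlocks 0 M N 0).charpoly =
      X ^ Fintype.card κ * (M * N).charpoly.comp (X ^ 2) := by
  have h : (fromBlocks 0 M N 0).charmatrix *
      fromBlocks (scalar ι X) 0 (N.map C) (1 : Matrix κ κ R[X]) =
      fromBlocks (scalar ι (X ^ 2) - (M * N).map C) (-M.map C) 0 (scalar κ X) := by
    rw [charmatrix_fromBlocks, fromBlocks_multiply, charmatrix_zero, charmatrix_zero]
    congr 1
    · rw [← map_mul, Matrix.map_mul, Matrix.neg_mul, sq, sub_eq_add_neg]
    · simp
    · rw [Matrix.neg_mul, scalar_comm X (fun _ => Commute.all _ _), neg_add_cancel]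
    · simp
  have hdet := congrArg det h
  rw [det_mul, det_fromBlocks_zero₁₂, det_fromBlocks_zero₂₁, ← charpoly_comp] at hdet
  simp only [scalar_apply, det_diagonal, Finset.prod_const, Finset.card_univ, det_one,
    mul_one] at hdet
  rw [mul_comm, mul_comm (X ^ Fintype.card κ)]
  exact hdet

/-- The characteristic polynomial of the matrix obtained by repeating each row and each column
of `M` along a finite type `κ`. -/
theorem X_pow_mul_charpoly_submatrix_snd (M : Matrix ι ι R) :
    X ^ Fintype.card ι * (M.submatrix Prod.snd Prod.snd : Matrix (κ × ι) (κ × ι) R).charpoly =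
      X ^ (Fintype.card κ * Fintype.card ι) * (Fintype.card κ • M).charpoly := by
  have hl : M.submatrix (Prod.snd : κ × ι → ι) (Prod.snd : κ × ι → ι) =
      (1 : Matrix ι ι R).submatrix Prod.snd id * M.submatrix id Prod.snd := by
    ext a b
    simp [mul_apply, one_apply]
  have hr : Fintype.card κ • M =
      M.submatrix id (Prod.snd : κ × ι → ι) *
        (1 : Matrix ι ι R).submatrix (Prod.snd : κ × ι → ι) id := by
    ext i j
    rw [smul_apply]
    simp [mul_apply, one_apply, Fintype.sum_prod_type]
  rw [hl, hr, charpoly_mul_comm', Fintype.card_prod]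

end Matrix

theorem Npk_eq_fromBlocks {n m : ℕ} (p k : ℕ) (B : Matrix (Fin n) (Fin m) ℝ) :
    Npk p k B = fromBlocks 0 (B.submatrix Prod.snd Prod.snd)
      (Bᵀ.submatrix Prod.snd Prod.snd) 0 := by
  ext (x | x) (y | y) <;> rfl

theorem submatrix_snd_mul_transpose {n m : ℕ} (p k : ℕ) (B : Matrix (Fin n) (Fin m) ℝ) :
    (B.submatrix Prod.snd Prod.snd : Matrix (Fin (p + 1) × Fin n) (Fin (k + 1) × Fin m) ℝ) *
        (Bᵀ.submatrix Prod.snd Prod.snd : Matrix (Fin (k + 1) × Fin m) (Fin (p + 1) × Fin n) ℝ) =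
      ((k + 1 : ℕ) • (B * Bᵀ)).submatrix Prod.snd Prod.snd := by
  ext x y
  rw [submatrix_apply, Matrix.smul_apply]
  simp [mul_apply, Fintype.sum_prod_type]

/-- Theorem 4.4: for `k = p` or `k = p - 1`,
`X^(2n) * charpoly (S_p^k(Γ)) = X^((p+1)n + (k+1)m) * charpoly ((p+1)(k+1) • L) ∘ X²`,
where `L = B * Bᵀ`; i.e. the nonzero eigenvalues of `S_p^k(Γ)` are exactly
`±√((p+1)(k+1)μ)` over the nonzero Laplacian eigenvalues `μ`, and the rest are `0`. -/
theorem charpoly_Npk {n m : ℕ} (B : Matrix (Fin n) (Fin m) ℝ)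
    (hB : IsIncidence B) (p k : ℕ) (hp : 0 < p) (hk : k = p ∨ k = p - 1) :
    X ^ (2 * n) * (Npk p k B).charpoly =
      X ^ ((p + 1) * n + (k + 1) * m) *
        (((((p + 1) * (k + 1) : ℕ) : ℝ) • (B * Bᵀ)).charpoly).comp (X ^ 2) := by
  have hN := X_pow_mul_charpoly_fromBlocks_zero_zero_s7
    (B.submatrix Prod.snd Prod.snd : Matrix (Fin (p + 1) × Fin n) (Fin (k + 1) × Fin m) ℝ)
    (Bᵀ.submatrix Prod.snd Prod.snd)
  have hL := congrArg (fun q => q.comp (X ^ 2))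
    (X_pow_mul_charpoly_submatrix_snd (κ := Fin (p + 1)) ((k + 1 : ℕ) • (B * Bᵀ)))
  rw [← Npk_eq_fromBlocks, submatrix_snd_mul_transpose] at hN
  simp only [mul_comp, X_pow_comp, Fintype.card_prod, Fintype.card_fin, smul_smul,
    ← pow_mul] at hN hL
  rw [Nat.cast_smul_eq_nsmul]
  refine (isRegular_X_pow ((p + 1) * n)).left ?_
  linear_combination X ^ (2 * n) * hN + X ^ ((k + 1) * m) * hL
end

section
/- Let B : Matrix (Fin n) (Fin m) ℝ, let λ : ℝ, and let X : Fin n → ℝ, Y : Fin m → ℝ with (X, Y) ≠ 0 satisfy B.mulVec Y = λ • X and Bᵀ.mulVec X = λ • Y (so that ((X, Y)) is an eigenvector of the subdivision adjacency matrix with eigenvalue λ). Let p be a positive integer and k = p, and let U be the vector indexed by (Fin (p+1) × Fin n) ⊕ (Fin (k+1) × Fin m) given by U (Sum.inl (a, i)) = X i and U (Sum.inr (b, j)) = Y j. Then U ≠ 0 and (N_{p,k} B).mulVec U = ((p+1) * λ) • U; in particular (p+1)λ is an eigenvalue of N_{p,p} B. -/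
open Matrix

/-- Subcase 1.1 of the proof of Theorem 4.4 (case `k = p`): the vector `U` with
`U (Sum.inl (a, i)) = X i` and `U (Sum.inr (b, j)) = Y j` built from an eigenvector
`(X, Y)` of the subdivision adjacency matrix with eigenvalue `λ` is a nonzero
eigenvector of `N_{p,p} B` with eigenvalue `(p+1)λ`; in particular `(p+1)λ` is an
eigenvalue of `N_{p,p} B`. -/
theorem Npk_eigenvector_case_k_eq_p {n m : ℕ} (B : Matrix (Fin n) (Fin m) ℝ)
    (lam : ℝ) (X : Fin n → ℝ) (Y : Fin m → ℝ) (hXY : (X, Y) ≠ 0)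
    (h1 : B.mulVec Y = lam • X) (h2 : Bᵀ.mulVec X = lam • Y)
    (p : ℕ) (hp : 0 < p)
    (U : (Fin (p + 1) × Fin n) ⊕ (Fin (p + 1) × Fin m) → ℝ)
    (hUl : ∀ (a : Fin (p + 1)) (i : Fin n), U (Sum.inl (a, i)) = X i)
    (hUr : ∀ (b : Fin (p + 1)) (j : Fin m), U (Sum.inr (b, j)) = Y j) :
    U ≠ 0 ∧ (Npk p p B).mulVec U = (((p : ℝ) + 1) * lam) • U ∧
      Module.End.HasEigenvalue (Matrix.mulVecLin (Npk p p B)) (((p : ℝ) + 1) * lam) := by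
  have hU : U ≠ 0 := by
    rintro rfl
    refine hXY (Prod.ext (funext fun i => ?_) (funext fun j => ?_))
    · exact (hUl 0 i).symm
    · exact (hUr 0 j).symm
  have hmul : (Npk p p B).mulVec U = (((p : ℝ) + 1) * lam) • U := by
    ext (⟨a, i⟩ | ⟨b, j⟩)
    · have h := congrFun h1 i
      simp only [mulVec, dotProduct, Pi.smul_apply, smul_eq_mul] at h
      simp [Npk, mulVec, dotProduct, Fintype.sum_prod_type, hUl, hUr, h, mul_assoc]
    · have h := congrFun h2 j
      simp only [mulVec, dotProduct, transpose_apply, Pi.smul_apply, smul_eq_mul] at h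
      simp [Npk, mulVec, dotProduct, Fintype.sum_prod_type, hUl, hUr, h, mul_assoc]
  exact ⟨hU, hmul, Module.End.hasEigenvalue_of_hasEigenvector
    ⟨Module.End.mem_eigenspace_iff.mpr hmul, hU⟩⟩
end

section
/- Let B : Matrix (Fin n) (Fin m) ℝ, let λ : ℝ, and let X : Fin n → ℝ, Y : Fin m → ℝ with (X, Y) ≠ 0 satisfy B.mulVec Y = λ • X and Bᵀ.mulVec X = λ • Y. Let p be a positive integer and k = p - 1, and let U be the vector indexed by (Fin (p+1) × Fin n) ⊕ (Fin (k+1) × Fin m) given by U (Sum.inl (a, i)) = √(k+1) * X i and U (Sum.inr (b, j)) = √(p+1) * Y j. Then U ≠ 0 and (N_{p,k} B).mulVec U = (√((k+1)*(p+1)) * λ) • U; in particular √((p+1)(k+1))·λ is an eigenvalue of N_{p,p-1} B. -/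
open Matrix

theorem Npk_mulVec_inl {n m : ℕ} (p k : ℕ) (B : Matrix (Fin n) (Fin m) ℝ)
    (U : (Fin (p + 1) × Fin n) ⊕ (Fin (k + 1) × Fin m) → ℝ) (a : Fin (p + 1)) (i : Fin n) :
    (Npk p k B).mulVec U (Sum.inl (a, i)) = ∑ b, B.mulVec (fun j => U (Sum.inr (b, j))) i := by
  simp [Npk, Matrix.mulVec, dotProduct, Fintype.sum_prod_type]

theorem Npk_mulVec_inr {n m : ℕ} (p k : ℕ) (B : Matrix (Fin n) (Fin m) ℝ)
    (U : (Fin (p + 1) × Fin n) ⊕ (Fin (k + 1) × Fin m) → ℝ) (b : Fin (k + 1)) (j : Fin m) :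
    (Npk p k B).mulVec U (Sum.inr (b, j)) = ∑ a, Bᵀ.mulVec (fun i => U (Sum.inl (a, i))) j := by
  simp [Npk, Matrix.mulVec, dotProduct, Fintype.sum_prod_type]

/-- Subcase 1.2 of the proof of Theorem 4.4 (case `k = p - 1`): the vector `U` with
`U (Sum.inl (a, i)) = √(k+1) * X i` and `U (Sum.inr (b, j)) = √(p+1) * Y j` built
from an eigenvector `(X, Y)` of the subdivision adjacency matrix with eigenvalue
`λ` is a nonzero eigenvector of `N_{p,k} B` with eigenvalue `√((k+1)(p+1)) λ`; in
particular `√((p+1)(k+1)) λ` is an eigenvalue of `N_{p,p-1} B`. -/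
theorem Npk_eigenvector_case_k_eq_p_sub_one {n m : ℕ} (B : Matrix (Fin n) (Fin m) ℝ)
    (lam : ℝ) (X : Fin n → ℝ) (Y : Fin m → ℝ) (hXY : (X, Y) ≠ 0)
    (h1 : B.mulVec Y = lam • X) (h2 : Bᵀ.mulVec X = lam • Y)
    (p k : ℕ) (hp : 0 < p) (hk : k = p - 1)
    (U : (Fin (p + 1) × Fin n) ⊕ (Fin (k + 1) × Fin m) → ℝ)
    (hUl : ∀ (a : Fin (p + 1)) (i : Fin n),
      U (Sum.inl (a, i)) = Real.sqrt ((k : ℝ) + 1) * X i)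
    (hUr : ∀ (b : Fin (k + 1)) (j : Fin m),
      U (Sum.inr (b, j)) = Real.sqrt ((p : ℝ) + 1) * Y j) :
    U ≠ 0 ∧
      (Npk p k B).mulVec U = (Real.sqrt (((k : ℝ) + 1) * ((p : ℝ) + 1)) * lam) • U ∧
      Module.End.HasEigenvalue (Matrix.mulVecLin (Npk p k B))
        (Real.sqrt (((k : ℝ) + 1) * ((p : ℝ) + 1)) * lam) := by
  have hk0 : (0 : ℝ) < (k : ℝ) + 1 := by positivity
  have hp0 : (0 : ℝ) < (p : ℝ) + 1 := by positivity
  have hU : U ≠ 0 := by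
    rintro rfl
    refine hXY (Prod.ext (funext fun i => ?_) (funext fun j => ?_))
    · exact (mul_eq_zero.mp (hUl 0 i).symm).resolve_left (Real.sqrt_pos.mpr hk0).ne'
    · exact (mul_eq_zero.mp (hUr 0 j).symm).resolve_left (Real.sqrt_pos.mpr hp0).ne'
  have hNU : (Npk p k B).mulVec U =
      (Real.sqrt (((k : ℝ) + 1) * ((p : ℝ) + 1)) * lam) • U := by
    rw [Real.sqrt_mul hk0.le]
    funext x
    rcases x with ⟨a, i⟩ | ⟨b, j⟩
    · have hY (b : Fin (k + 1)) :
          (fun j => U (Sum.inr (b, j))) = Real.sqrt ((p : ℝ) + 1) • Y := funext (hUr b)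
      simp only [Npk_mulVec_inl, hY, mulVec_smul, h1, Pi.smul_apply, smul_eq_mul, hUl,
        Finset.sum_const, Finset.card_univ, Fintype.card_fin, nsmul_eq_mul]
      push_cast
      linear_combination (-Real.sqrt ((p : ℝ) + 1) * lam * X i) * Real.mul_self_sqrt hk0.le
    · have hX (a : Fin (p + 1)) :
          (fun i => U (Sum.inl (a, i))) = Real.sqrt ((k : ℝ) + 1) • X := funext (hUl a)
      simp only [Npk_mulVec_inr, hX, mulVec_smul, h2, Pi.smul_apply, smul_eq_mul, hUr,
        Finset.sum_const, Finset.card_univ, Fintype.card_fin, nsmul_eq_mul]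
      push_cast
      linear_combination (-Real.sqrt ((k : ℝ) + 1) * lam * Y j) * Real.mul_self_sqrt hp0.le
  exact ⟨hU, hNU, Module.End.hasEigenvalue_of_hasEigenvector
    ⟨Module.End.mem_eigenspace_iff.mpr hNU, hU⟩⟩
end

section
/- Let B : Matrix (Fin n) (Fin m) ℝ be an incidence matrix of a signed graph Γ such that every eigenvalue of the Laplacian L = B * Bᵀ is the square of a natural number (i.e., writing hL for the fact that L is Hermitian, for every i there exists t : ℕ with hL.eigenvalues i = (t : ℝ)^2). If p = q^2 for some positive natural number q, then the signed graph S_p(Γ) is integral: every eigenvalue of the symmetric matrix M_p B is an integer. -/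
open Matrix

/-- A nonzero solution of `A *ᵥ x = μ • x` puts `μ` in the spectrum of `A`. -/
theorem mem_spectrum_of_mulVec_eq_smul {ι : Type*} [Fintype ι] [DecidableEq ι]
    {A : Matrix ι ι ℝ} {x : ι → ℝ} {μ : ℝ} (hx : x ≠ 0) (h : A *ᵥ x = μ • x) :
    μ ∈ spectrum ℝ A := by
  rw [← Matrix.spectrum_toLin']
  refine (Module.End.hasEigenvalue_of_hasEigenvector (x := x) ⟨?_, hx⟩).mem_spectrum
  rw [Module.End.mem_eigenspace_iff, Matrix.toLin'_apply, h]

theorem Mp_mulVec_inl {n m : ℕ} (p : ℕ) (B : Matrix (Fin n) (Fin m) ℝ)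
    (v : Fin n ⊕ (Fin p × Fin m) → ℝ) (i : Fin n) :
    (Mp p B *ᵥ v) (Sum.inl i) = ∑ a : Fin p, ∑ j, B i j * v (Sum.inr (a, j)) := by
  simp [Mp, Matrix.mulVec, dotProduct, Fintype.sum_prod_type]

theorem Mp_mulVec_inr {n m : ℕ} (p : ℕ) (B : Matrix (Fin n) (Fin m) ℝ)
    (v : Fin n ⊕ (Fin p × Fin m) → ℝ) (a : Fin p) (j : Fin m) :
    (Mp p B *ᵥ v) (Sum.inr (a, j)) = (Bᵀ *ᵥ (v ∘ Sum.inl)) j := by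
  simp [Mp, Matrix.mulVec, dotProduct]

/-- The vertex part of an eigenvector of `Mp p B` for `μ` satisfies the eigenvalue equation of
`p • (B * Bᵀ)` for `μ ^ 2`. -/
theorem laplacian_mulVec_of_Mp_mulVec {n m : ℕ} {p : ℕ} {B : Matrix (Fin n) (Fin m) ℝ}
    {v : Fin n ⊕ (Fin p × Fin m) → ℝ} {μ : ℝ} (h : Mp p B *ᵥ v = μ • v) :
    (p : ℝ) • ((B * Bᵀ) *ᵥ (v ∘ Sum.inl)) = μ ^ 2 • (v ∘ Sum.inl) := by
  ext i
  have hl : ∑ a : Fin p, ∑ j, B i j * v (Sum.inr (a, j)) = μ * v (Sum.inl i) := by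
    rw [← Mp_mulVec_inl, h]; rfl
  have hr (a : Fin p) (j : Fin m) :
      (Bᵀ *ᵥ (v ∘ Sum.inl)) j = μ * v (Sum.inr (a, j)) := by
    rw [← Mp_mulVec_inr p B v a j, h]; rfl
  calc (p : ℝ) * ((B * Bᵀ) *ᵥ (v ∘ Sum.inl)) i
      = ∑ _a : Fin p, ∑ j, B i j * (Bᵀ *ᵥ (v ∘ Sum.inl)) j := by
        rw [← Matrix.mulVec_mulVec, Finset.sum_const, Finset.card_univ, Fintype.card_fin,
          nsmul_eq_mul]
        rfl
    _ = μ * ∑ a : Fin p, ∑ j, B i j * v (Sum.inr (a, j)) := by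
        simp only [Finset.mul_sum]
        refine Finset.sum_congr rfl fun a _ => Finset.sum_congr rfl fun j _ => ?_
        rw [hr a j]; ring
    _ = μ ^ 2 * v (Sum.inl i) := by rw [hl]; ring

/-- An eigenvector of `Mp p B` for a nonzero eigenvalue has nonzero vertex part. -/
theorem comp_inl_ne_zero_of_Mp_mulVec {n m : ℕ} {p : ℕ} {B : Matrix (Fin n) (Fin m) ℝ}
    {v : Fin n ⊕ (Fin p × Fin m) → ℝ} {μ : ℝ} (h : Mp p B *ᵥ v = μ • v) (hμ : μ ≠ 0)
    (hv : v ≠ 0) : v ∘ Sum.inl ≠ 0 := by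
  intro hx
  refine hv (funext ?_)
  rintro (i | ⟨a, j⟩)
  · exact congrFun hx i
  · have hr := Mp_mulVec_inr p B v a j
    rw [h, hx, Matrix.mulVec_zero] at hr
    exact (mul_eq_zero.mp hr).resolve_left hμ

/-- Corollary 4.7(i): if all the Laplacian eigenvalues of `Γ` are perfect squares
(squares of natural numbers) and `p` is a perfect square, then the signed graph
`S_p(Γ)` is integral: all its adjacency eigenvalues are integers. -/
theorem Mp_integral {n m : ℕ} (B : Matrix (Fin n) (Fin m) ℝ)
    (hB : IsIncidence B) (hL : (B * Bᵀ).IsHermitian)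
    (hsq : ∀ i, ∃ t : ℕ, hL.eigenvalues i = (t : ℝ) ^ 2)
    (p q : ℕ) (hq : 0 < q) (hpq : p = q ^ 2)
    (hM : (Mp p B).IsHermitian) :
    ∀ i, ∃ z : ℤ, hM.eigenvalues i = (z : ℝ) := by
  intro i
  have hMv : Mp p B *ᵥ ⇑(hM.eigenvectorBasis i) =
      hM.eigenvalues i • ⇑(hM.eigenvectorBasis i) := hM.mulVec_eigenvectorBasis i
  have hv : ⇑(hM.eigenvectorBasis i) ≠ 0 := fun h0 =>
    hM.eigenvectorBasis.orthonormal.ne_zero i (by ext k; exact congrFun h0 k)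
  generalize hM.eigenvalues i = μ at hMv ⊢
  by_cases hμ : μ = 0
  · exact ⟨0, by simp [hμ]⟩
  have hq0 : (q : ℝ) ≠ 0 := by exact_mod_cast hq.ne'
  have hp : (p : ℝ) = (q : ℝ) ^ 2 := by rw [hpq]; push_cast; rfl
  have hLv : (B * Bᵀ) *ᵥ (⇑(hM.eigenvectorBasis i) ∘ Sum.inl) =
      (μ / q) ^ 2 • (⇑(hM.eigenvectorBasis i) ∘ Sum.inl) := by
    rw [div_pow, div_eq_inv_mul, mul_smul, ← laplacian_mulVec_of_Mp_mulVec hMv, hp,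
      inv_smul_smul₀ (pow_ne_zero 2 hq0)]
  have hmem := mem_spectrum_of_mulVec_eq_smul (comp_inl_ne_zero_of_Mp_mulVec hMv hμ hv) hLv
  rw [hL.spectrum_real_eq_range_eigenvalues] at hmem
  obtain ⟨k, hk⟩ := hmem
  obtain ⟨t, ht⟩ := hsq k
  rcases sq_eq_sq_iff_eq_or_eq_neg.mp (hk.symm.trans ht) with h | h
  · exact ⟨t * q, by rw [(div_eq_iff hq0).mp h]; push_cast; rfl⟩
  · exact ⟨-t * q, by rw [(div_eq_iff hq0).mp h]; push_cast; rfl⟩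
end

section
/- Let B : Matrix (Fin n) (Fin m) ℝ be an incidence matrix of a signed graph Γ and let p be a positive integer. Then the energy of S_p(Γ) equals √p times the energy of the subdivision signed graph S(Γ): energy(M_p B) = Real.sqrt p * energy(M_1 B). -/
open Matrix

/-- The energy of a real symmetric matrix: the sum of the absolute values of its
eigenvalues, listed with multiplicity. -/
noncomputable def energy {N : Type*} [Fintype N] [DecidableEq N]
    (A : Matrix N N ℝ) : ℝ := by
  classical exact if h : A.IsHermitian then ∑ i, |h.eigenvalues i| else 0

open Polynomial in
/-- The sum of the square roots of the real roots of a polynomial, with multiplicity. -/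
noncomputable def sumSqrtRoots (f : ℝ[X]) : ℝ := (f.roots.map Real.sqrt).sum

open Polynomial in
lemma sumSqrtRoots_mul {f g : ℝ[X]} (hf : f ≠ 0) (hg : g ≠ 0) :
    sumSqrtRoots (f * g) = sumSqrtRoots f + sumSqrtRoots g := by
  simp [sumSqrtRoots, roots_mul (mul_ne_zero hf hg)]

open Polynomial in
lemma sumSqrtRoots_X_pow (k : ℕ) : sumSqrtRoots (X ^ k : ℝ[X]) = 0 := by
  simp [sumSqrtRoots, Multiset.map_nsmul, Multiset.sum_nsmul]

open Polynomial in
lemma sumSqrtRoots_prod {ι : Type*} [Fintype ι] (r : ι → ℝ) :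
    sumSqrtRoots (∏ i, (X - C (r i))) = ∑ i, √(r i) := by
  rw [sumSqrtRoots, roots_prod _ _ (Finset.prod_ne_zero_iff.2 fun i _ => X_sub_C_ne_zero _)]
  simp [Multiset.bind_singleton]

lemma energy_eq_sumSqrtRoots {N : Type*} [Fintype N] [DecidableEq N] {A : Matrix N N ℝ}
    (hA : A.IsHermitian) : energy A = sumSqrtRoots (A * A).charpoly := by
  have hcfc : A * A = cfc (fun x : ℝ => x ^ 2) A := by
    rw [cfc_pow_id (R := ℝ) A 2 hA.isSelfAdjoint, sq]
  rw [hcfc, hA.charpoly_cfc_eq, energy, dif_pos hA]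
  simp_rw [← Real.sqrt_sq_eq_abs]
  exact (sumSqrtRoots_prod fun i => hA.eigenvalues i ^ 2).symm

lemma sumSqrtRoots_charpoly_smul {N : Type*} [Fintype N] [DecidableEq N] {A : Matrix N N ℝ}
    (hA : A.IsHermitian) {c : ℝ} (hc : 0 ≤ c) :
    sumSqrtRoots (c • A).charpoly = √c * sumSqrtRoots A.charpoly := by
  have hcfc : c • A = cfc (fun x : ℝ => c * x) A :=
    (cfc_const_mul_id (R := ℝ) c A hA.isSelfAdjoint).symm
  rw [hcfc, hA.charpoly_cfc_eq, hA.charpoly_eq]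
  simpa [Real.sqrt_mul hc, Finset.mul_sum, sumSqrtRoots_prod] using
    sumSqrtRoots_prod fun i => c * hA.eigenvalues i

lemma sumSqrtRoots_charpoly_mul_comm {k l : Type*} [Fintype k] [DecidableEq k] [Fintype l]
    [DecidableEq l] (A : Matrix k l ℝ) (B : Matrix l k ℝ) :
    sumSqrtRoots (A * B).charpoly = sumSqrtRoots (B * A).charpoly := by
  have h := congrArg sumSqrtRoots (charpoly_mul_comm' A B)
  rwa [sumSqrtRoots_mul (pow_ne_zero _ Polynomial.X_ne_zero) (charpoly_monic _).ne_zero,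
    sumSqrtRoots_mul (pow_ne_zero _ Polynomial.X_ne_zero) (charpoly_monic _).ne_zero,
    sumSqrtRoots_X_pow, sumSqrtRoots_X_pow, zero_add, zero_add] at h

/-- The energy of a bipartite adjacency matrix is twice the sum of the singular values of its
biadjacency matrix. -/
lemma energy_fromBlocks_zero {k l : Type*} [Fintype k] [DecidableEq k] [Fintype l]
    [DecidableEq l] (C : Matrix k l ℝ) :
    energy (fromBlocks 0 C Cᵀ 0) = 2 * sumSqrtRoots (C * Cᵀ).charpoly := by
  have hA : (fromBlocks 0 C Cᵀ 0).IsHermitian :=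
    IsHermitian.fromBlocks isHermitian_zero (by simp) isHermitian_zero
  rw [energy_eq_sumSqrtRoots hA, fromBlocks_multiply]
  simp only [Matrix.mul_zero, Matrix.zero_mul, zero_add, add_zero]
  rw [charpoly_fromBlocks_zero₁₂,
    sumSqrtRoots_mul (charpoly_monic _).ne_zero (charpoly_monic _).ne_zero,
    sumSqrtRoots_charpoly_mul_comm Cᵀ C, two_mul]

lemma energy_Mp_eq {n m : ℕ} (p : ℕ) (B : Matrix (Fin n) (Fin m) ℝ) :
    energy (Mp p B) = 2 * (√p * sumSqrtRoots (B * Bᵀ).charpoly) := by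
  let C : Matrix (Fin n) (Fin p × Fin m) ℝ := of fun i aj => B i aj.2
  have hM : Mp p B = fromBlocks 0 C Cᵀ 0 := by
    ext (i | i) (j | j) <;> rfl
  have hC : C * Cᵀ = (p : ℝ) • (B * Bᵀ) := by
    ext i j
    simp [C, mul_apply, Fintype.sum_prod_type]
  rw [hM, energy_fromBlocks_zero, hC,
    sumSqrtRoots_charpoly_smul (by simpa using isHermitian_mul_conjTranspose_self B)
      (Nat.cast_nonneg p)]

/-- Theorem 4.9(i): `𝓔(S_p(Γ)) = √p ⬝ 𝓔(S(Γ))`. -/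
theorem energy_Mp {n m : ℕ} (B : Matrix (Fin n) (Fin m) ℝ)
    (hB : IsIncidence B) (p : ℕ) (hp : 0 < p) :
    energy (Mp p B) = Real.sqrt p * energy (Mp 1 B) := by
  rw [energy_Mp_eq, energy_Mp_eq, Nat.cast_one, Real.sqrt_one]
  ring
end

section
/- Let B : Matrix (Fin n) (Fin m) ℝ be an incidence matrix of a signed graph Γ, let p be a positive integer and k = p or k = p - 1. Then the energy of S_p^k(Γ) equals √((p+1)(k+1)) times the energy of the subdivision signed graph S(Γ): energy(N_{p,k} B) = Real.sqrt ((p+1)*(k+1)) * energy(M_1 B), where M_1 B is the symmetric matrix on Fin n ⊕ (Fin 1 × Fin m) with (M_1 B) (Sum.inl i) (Sum.inr (a, j)) = (M_1 B) (Sum.inr (a, j)) (Sum.inl i) = B i j and all other entries 0. -/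
open Matrix

theorem isHermitian_mul_diagonal_mul_transpose {N K : Type*} [Fintype K] [DecidableEq K]
    (W : Matrix N K ℝ) (d : K → ℝ) : (W * diagonal d * Wᵀ).IsHermitian := by
  simp [Matrix.IsHermitian, conjTranspose_eq_transpose_of_trivial, Matrix.mul_assoc]

theorem energy_eq_sum_abs_roots {N : Type*} [Fintype N] [DecidableEq N]
    {A : Matrix N N ℝ} (hA : A.IsHermitian) :
    energy A = (A.charpoly.roots.map abs).sum := by
  rw [energy, dif_pos hA, hA.roots_charpoly_eq_eigenvalues]
  simp

/-- The energy can be read off any factorization through an isometry. -/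
theorem energy_eq_of_factorization {N K : Type*} [Fintype N] [DecidableEq N]
    [Fintype K] [DecidableEq K] {A : Matrix N N ℝ} (W : Matrix N K ℝ) (d : K → ℝ)
    (hW : Wᵀ * W = 1) (hA : A = W * diagonal d * Wᵀ) :
    energy A = ∑ i, |d i| := by
  have hcp : Polynomial.X ^ Fintype.card K * A.charpoly =
      Polynomial.X ^ Fintype.card N * ∏ i, (Polynomial.X - Polynomial.C (d i)) := by
    rw [hA, Matrix.mul_assoc, charpoly_mul_comm', Matrix.mul_assoc, hW, Matrix.mul_one,
      charpoly_diagonal]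
  have hne : (∏ i, (Polynomial.X - Polynomial.C (d i))) ≠ 0 :=
    Finset.prod_ne_zero_iff.mpr fun i _ => Polynomial.X_sub_C_ne_zero (d i)
  have hroots := congrArg (fun q => (q.roots.map abs).sum) hcp
  simp only [Polynomial.roots_mul (mul_ne_zero (pow_ne_zero _ Polynomial.X_ne_zero)
      A.charpoly_monic.ne_zero),
    Polynomial.roots_mul (mul_ne_zero (pow_ne_zero _ Polynomial.X_ne_zero) hne),
    Polynomial.roots_prod _ _ hne] at hroots
  rw [energy_eq_sum_abs_roots (hA ▸ isHermitian_mul_diagonal_mul_transpose W d)]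
  simpa [Multiset.bind_singleton, Multiset.map_nsmul, Multiset.sum_nsmul] using hroots

theorem Mp_isHermitian {n m : ℕ} (p : ℕ) (B : Matrix (Fin n) (Fin m) ℝ) :
    (Mp p B).IsHermitian := by
  ext (i | i) (j | j) <;> simp [Mp]

/-- The normalized isometry that sends each vertex of the subdivision signed graph to the
sum of its copies in `S_p^k(Γ)`. -/
noncomputable def copies (n m p k : ℕ) :
    Matrix ((Fin (p + 1) × Fin n) ⊕ (Fin (k + 1) × Fin m)) (Fin n ⊕ (Fin 1 × Fin m)) ℝ :=
  fromBlocks (of fun a i => if a.2 = i then (√(p + 1))⁻¹ else 0) 0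
    0 (of fun b j => if b.2 = j.2 then (√(k + 1))⁻¹ else 0)

theorem copies_transpose_mul_self (n m p k : ℕ) :
    (copies n m p k)ᵀ * copies n m p k = 1 := by
  have h (q : ℕ) : ((q : ℝ) + 1) * ((√(q + 1))⁻¹ * (√(q + 1))⁻¹) = 1 := by
    rw [← mul_inv, Real.mul_self_sqrt (by positivity), mul_inv_cancel₀ (by positivity)]
  ext (i | ⟨a, i⟩) (j | ⟨b, j⟩)
  · by_cases hij : j = i <;>
      simp [copies, Matrix.mul_apply, Fintype.sum_prod_type, Matrix.one_apply, h, hij, eq_comm (a := i)]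
  · simp [copies, Matrix.mul_apply]
  · simp [copies, Matrix.mul_apply]
  · by_cases hij : j = i <;>
      simp [copies, Matrix.mul_apply, Fintype.sum_prod_type, Matrix.one_apply, h, hij, eq_comm (a := i),
        Subsingleton.elim a b]

theorem Npk_eq_copies_mul {n m : ℕ} (p k : ℕ) (B : Matrix (Fin n) (Fin m) ℝ) :
    Npk p k B =
      copies n m p k * (√((p + 1) * (k + 1) : ℕ) • Mp 1 B) * (copies n m p k)ᵀ := by
  have hp : √((p : ℝ) + 1) ≠ 0 := by positivity
  have hk : √((k : ℝ) + 1) ≠ 0 := by positivity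
  have hs : √((p + 1) * (k + 1) : ℕ) = √((p : ℝ) + 1) * √((k : ℝ) + 1) := by
    push_cast
    exact Real.sqrt_mul (by positivity) _
  rw [hs]
  ext (⟨a, i⟩ | ⟨a, i⟩) (⟨b, j⟩ | ⟨b, j⟩) <;>
    simp [copies, Npk, Mp, Matrix.mul_apply, Fintype.sum_prod_type] <;> field_simp

/-- Theorem 4.9(ii): `𝓔(S_p^k(Γ)) = √((p+1)(k+1)) ⬝ 𝓔(S(Γ))` for `k = p` or
`k = p - 1`. -/
theorem energy_Npk {n m : ℕ} (B : Matrix (Fin n) (Fin m) ℝ)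
    (hB : IsIncidence B) (p k : ℕ) (hp : 0 < p) (hk : k = p ∨ k = p - 1) :
    energy (Npk p k B) = Real.sqrt (((p + 1) * (k + 1) : ℕ)) * energy (Mp 1 B) := by
  have hM := Mp_isHermitian 1 B
  set U : Matrix (Fin n ⊕ (Fin 1 × Fin m)) (Fin n ⊕ (Fin 1 × Fin m)) ℝ :=
    hM.eigenvectorUnitary.1
  have hUU : Uᵀ * U = 1 := by
    simpa [star_eq_conjTranspose, conjTranspose_eq_transpose_of_trivial] using
      Unitary.coe_star_mul_self hM.eigenvectorUnitary
  have hspec : Mp 1 B = U * diagonal hM.eigenvalues * Uᵀ := by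
    simpa [Unitary.conjStarAlgAut_apply, star_eq_conjTranspose,
      conjTranspose_eq_transpose_of_trivial, Function.comp_def] using hM.spectral_theorem
  set c := √((p + 1) * (k + 1) : ℕ)
  rw [energy_eq_of_factorization U hM.eigenvalues hUU hspec,
    energy_eq_of_factorization (copies n m p k * U) (c • hM.eigenvalues)]
  · simp only [Pi.smul_apply, smul_eq_mul, abs_mul, abs_of_nonneg (Real.sqrt_nonneg _), c,
      Finset.mul_sum]
  · rw [transpose_mul, Matrix.mul_assoc, ← Matrix.mul_assoc _ _ U, copies_transpose_mul_self,
      Matrix.one_mul, hUU]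
  · rw [Npk_eq_copies_mul]
    nth_rw 1 [hspec]
    simp [diagonal_smul, Matrix.mul_assoc, transpose_mul, c]
end
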